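/- arXiv:1710.11501 — 6 statements merged into one kernel-verified Lean document; each statement's English description precedes it below -/
import Mathlib

section
/- Let α ∈ ℝ with 0 < sin α < 1. Let v, u ∈ ℝ³ with v ≠ 0, ‖u‖ = 1, and ‖u × v‖² = ‖v‖² sin²α (i.e. the angle-of-attack constraint c₂(v,u) = ‖u×v‖²/(‖v‖² sin²α) − 1 is active). Then the vectors ‖v‖² u − (u·v) v and u are linearly independent in ℝ³; equivalently, the 3×2 matrix whose columns are the gradient (with respect to u) of c₂(v,u) and the vector u has rank 2. -/
open Real

/-- Euclidean dot product on ℝ³. -/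
noncomputable def dot3 (u v : Fin 3 → ℝ) : ℝ := u 0 * v 0 + u 1 * v 1 + u 2 * v 2

/-- Cross product on ℝ³. -/
noncomputable def cross3 (u v : Fin 3 → ℝ) : Fin 3 → ℝ :=
  ![u 1 * v 2 - u 2 * v 1, u 2 * v 0 - u 0 * v 2, u 0 * v 1 - u 1 * v 0]

/-- Euclidean norm on ℝ³. -/
noncomputable def norm3 (u : Fin 3 → ℝ) : ℝ := Real.sqrt (dot3 u u)

theorem dot3_self_nonneg (v : Fin 3 → ℝ) : 0 ≤ dot3 v v := by
  unfold dot3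
  nlinarith [sq_nonneg (v 0), sq_nonneg (v 1), sq_nonneg (v 2)]

theorem dot3_self_pos {v : Fin 3 → ℝ} (hv : v ≠ 0) : 0 < dot3 v v := by
  refine (dot3_self_nonneg v).lt_of_ne' fun h => hv ?_
  unfold dot3 at h
  have h0 : v 0 = 0 := by nlinarith [sq_nonneg (v 0), sq_nonneg (v 1), sq_nonneg (v 2)]
  have h1 : v 1 = 0 := by nlinarith [sq_nonneg (v 0), sq_nonneg (v 1), sq_nonneg (v 2)]
  have h2 : v 2 = 0 := by nlinarith [sq_nonneg (v 0), sq_nonneg (v 1), sq_nonneg (v 2)]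
  ext i
  fin_cases i <;> assumption

theorem norm3_sq (v : Fin 3 → ℝ) : norm3 v ^ 2 = dot3 v v :=
  Real.sq_sqrt (dot3_self_nonneg v)

/-- Lagrange's identity. -/
theorem dot3_cross3_self (u v : Fin 3 → ℝ) :
    dot3 (cross3 u v) (cross3 u v) = dot3 u u * dot3 v v - dot3 u v ^ 2 := by
  simp [dot3, cross3]
  ring

/-- If `v` is neither parallel nor orthogonal to `u`, then `‖v‖² u - (u·v) v` and `u` are
linearly independent. -/
theorem linearIndependent_dot3_smul_sub {u v : Fin 3 → ℝ} (hd : dot3 u v ≠ 0)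
    (hc : dot3 u u * dot3 v v - dot3 u v ^ 2 ≠ 0) :
    LinearIndependent ℝ ![dot3 v v • u - dot3 u v • v, u] := by
  rw [LinearIndependent.pair_iff]
  intro s t h
  have hi (i : Fin 3) : s * (dot3 v v * u i - dot3 u v * v i) + t * u i = 0 := by
    simpa using congrFun h i
  have htd : t * dot3 u v = 0 := by
    have h0 := hi 0
    have h1 := hi 1
    have h2 := hi 2
    unfold dot3 at *
    linear_combination v 0 * h0 + v 1 * h1 + v 2 * h2
  have ht : t = 0 := (mul_eq_zero.mp htd).resolve_right hd
  have hsc : s * (dot3 u u * dot3 v v - dot3 u v ^ 2) = 0 := by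
    have h0 := hi 0
    have h1 := hi 1
    have h2 := hi 2
    subst ht
    unfold dot3 at *
    linear_combination u 0 * h0 + u 1 * h1 + u 2 * h2
  exact ⟨(mul_eq_zero.mp hsc).resolve_right hc, ht⟩

/-- If `0 < sin α < 1`, `v ≠ 0`, `‖u‖ = 1` and the angle-of-attack constraint
`‖u × v‖² = ‖v‖² sin²α` is active, then the gradient direction `‖v‖² u - (u·v) v`
and `u` are linearly independent (so the rank condition holds). -/
theorem stmt0 (α : ℝ) (hα0 : 0 < sin α) (hα1 : sin α < 1)
    (v u : Fin 3 → ℝ) (hv : v ≠ 0) (hu : norm3 u = 1)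
    (hactive : (norm3 (cross3 u v)) ^ 2 = (norm3 v) ^ 2 * (sin α) ^ 2) :
    LinearIndependent ℝ ![dot3 v v • u - dot3 u v • v, u] := by
  have huu : dot3 u u = 1 := by rw [← norm3_sq, hu, one_pow]
  have hvv := dot3_self_pos hv
  rw [norm3_sq, norm3_sq, dot3_cross3_self] at hactive
  refine linearIndependent_dot3_smul_sub (fun hd => ?_) ?_
  · rw [hd, huu] at hactive
    have hsq : sin α ^ 2 < 1 := pow_lt_one₀ hα0.le hα1 two_ne_zero
    nlinarith
  · rw [hactive]
    positivity
end

section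
/- Let I ⊆ ℝ be an open interval and r, L, ℓ, v, γ, χ : I → ℝ be differentiable with r(t) > 0, v(t) > 0 and cos L(t) ≠ 0 for all t. Define the position curve r_vec(t) = (r cos L cos ℓ, r cos L sin ℓ, r sin L)(t) ∈ ℝ³ (so that r_vec = −r·e_r). If r_vec'(t) = v(t)·i₁(L(t),ℓ(t),γ(t),χ(t)) for all t ∈ I, then for all t ∈ I: r'(t) = v sin γ, L'(t) = (v/r) cos γ cos χ, and ℓ'(t) = (v/r) cos γ sin χ / cos L. -/
open Real

/-- North vector of the NED frame. -/
noncomputable def eL (L l : ℝ) : Fin 3 → ℝ :=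
  ![-(sin L * cos l), -(sin L * sin l), cos L]

/-- East vector of the NED frame. -/
noncomputable def el (L l : ℝ) : Fin 3 → ℝ :=
  ![-sin l, cos l, 0]

/-- Down vector of the NED frame. -/
noncomputable def er (L l : ℝ) : Fin 3 → ℝ :=
  ![-(cos L * cos l), -(cos L * sin l), -sin L]

/-- First vector of the first velocity frame. -/
noncomputable def i1 (L l γ χ : ℝ) : Fin 3 → ℝ :=
  (cos γ * cos χ) • eL L l + (cos γ * sin χ) • el L l - sin γ • er L l

/-- If the position curve `r_vec = (r cos L cos ℓ, r cos L sin ℓ, r sin L)` satisfies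
`r_vec' = v · i₁`, then `r' = v sin γ`, `L' = (v/r) cos γ cos χ`,
`ℓ' = (v/r) cos γ sin χ / cos L`. -/
theorem stmt3 (a b : ℝ) (r L l v γ χ r' L' l' v' γ' χ' : ℝ → ℝ)
    (hrpos : ∀ t ∈ Set.Ioo a b, 0 < r t)
    (hvpos : ∀ t ∈ Set.Ioo a b, 0 < v t)
    (hcosL : ∀ t ∈ Set.Ioo a b, cos (L t) ≠ 0)
    (hr : ∀ t ∈ Set.Ioo a b, HasDerivAt r (r' t) t)
    (hL : ∀ t ∈ Set.Ioo a b, HasDerivAt L (L' t) t)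
    (hl : ∀ t ∈ Set.Ioo a b, HasDerivAt l (l' t) t)
    (hv : ∀ t ∈ Set.Ioo a b, HasDerivAt v (v' t) t)
    (hγ : ∀ t ∈ Set.Ioo a b, HasDerivAt γ (γ' t) t)
    (hχ : ∀ t ∈ Set.Ioo a b, HasDerivAt χ (χ' t) t)
    (hrvec : ∀ t ∈ Set.Ioo a b,
      HasDerivAt
        (fun s => (![r s * cos (L s) * cos (l s),
                     r s * cos (L s) * sin (l s),
                     r s * sin (L s)] : Fin 3 → ℝ))
        (v t • i1 (L t) (l t) (γ t) (χ t)) t) :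
    ∀ t ∈ Set.Ioo a b,
      r' t = v t * sin (γ t) ∧
      L' t = (v t / r t) * cos (γ t) * cos (χ t) ∧
      l' t = (v t / r t) * (cos (γ t) * sin (χ t) / cos (L t)) := by
  intro t ht
  have hr0 : r t ≠ 0 := (hrpos t ht).ne'
  have hc0 := hcosL t ht
  have hcomp := hasDerivAt_pi.1 (hrvec t ht)
  have hcos := (hL t ht).cos
  have hx := (hcomp 0).unique (((hr t ht).mul hcos).mul (hl t ht).cos)
  have hy := (hcomp 1).unique (((hr t ht).mul hcos).mul (hl t ht).sin)
  have hz := (hcomp 2).unique ((hr t ht).mul (hL t ht).sin)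
  simp [i1, eL, el, er] at hx hy hz
  have hsL := sin_sq_add_cos_sq (L t)
  have hsl := sin_sq_add_cos_sq (l t)
  have hhor : v t * (sin (γ t) * cos (L t) - cos (γ t) * cos (χ t) * sin (L t)) =
      r' t * cos (L t) - r t * sin (L t) * L' t := by
    linear_combination cos (l t) * hx + sin (l t) * hy -
      (v t * (sin (γ t) * cos (L t) - cos (γ t) * cos (χ t) * sin (L t)) -
        (r' t * cos (L t) - r t * sin (L t) * L' t)) * hsl
  have heast : v t * (cos (γ t) * sin (χ t)) = r t * cos (L t) * l' t := by
    linear_combination cos (l t) * hy - sin (l t) * hx -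
      (v t * (cos (γ t) * sin (χ t)) - r t * cos (L t) * l' t) * hsl
  have hnorth : v t * (cos (γ t) * cos (χ t)) = r t * L' t := by
    linear_combination cos (L t) * hz - sin (L t) * hhor -
      (v t * (cos (γ t) * cos (χ t)) - r t * L' t) * hsL
  refine ⟨?_, ?_, ?_⟩
  · linear_combination -cos (L t) * hhor - sin (L t) * hz +
      (v t * sin (γ t) - r' t) * hsL
  · field_simp
    linear_combination -hnorth
  · field_simp
    linear_combination -heast
end

section
/- Let I ⊆ ℝ be an open interval and r, L, ℓ, v, γ, χ : I → ℝ be differentiable with r(t) > 0 and cos L(t) ≠ 0 for all t, and suppose the kinematic relations L'(t) = (v/r) cos γ cos χ and ℓ'(t) = (v/r) cos γ sin χ / cos L hold on I. Define v_vec(t) = v(t)·i₁(L(t),ℓ(t),γ(t),χ(t)) ∈ ℝ³. Then for all t ∈ I: v_vec'(t) = v'·i₁ + ( v γ' − (v²/r) cos γ )·j₁ + ( v cos γ · χ' − (v²/r) cos²γ sin χ tan L )·k₁, where the frame vectors on the right are evaluated at (L(t),ℓ(t),γ(t),χ(t)). -/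
open Real

/-- Second vector of the first velocity frame. -/
noncomputable def j1 (L l γ χ : ℝ) : Fin 3 → ℝ :=
  (-(sin γ * cos χ)) • eL L l + (-(sin γ * sin χ)) • el L l - cos γ • er L l

/-- Third vector of the first velocity frame. -/
noncomputable def k1 (L l γ χ : ℝ) : Fin 3 → ℝ :=
  (-sin χ) • eL L l + cos χ • el L l

theorem hasDerivAt_eL {L l : ℝ → ℝ} {L' l' t : ℝ}
    (hL : HasDerivAt L L' t) (hl : HasDerivAt l l' t) :
    HasDerivAt (fun s => eL (L s) (l s))
      (L' • er (L t) (l t) - (sin (L t) * l') • el (L t) (l t)) t := by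
  rw [hasDerivAt_pi]
  intro i
  fin_cases i
  · refine (hL.sin.mul hl.cos).neg.congr_deriv ?_
    simp [er, el]; ring
  · refine (hL.sin.mul hl.sin).neg.congr_deriv ?_
    simp [er, el]; ring
  · refine hL.cos.congr_deriv ?_
    simp [er, el]; ring

theorem hasDerivAt_el {l : ℝ → ℝ} {l' t : ℝ} (L : ℝ → ℝ) (hl : HasDerivAt l l' t) :
    HasDerivAt (fun s => el (L s) (l s))
      ((cos (L t) * l') • er (L t) (l t) + (sin (L t) * l') • eL (L t) (l t)) t := by
  have h := sin_sq_add_cos_sq (L t)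
  rw [hasDerivAt_pi]
  intro i
  fin_cases i
  · refine hl.sin.neg.congr_deriv ?_
    simp [er, eL]; linear_combination (cos (l t) * l') * h
  · refine hl.cos.congr_deriv ?_
    simp [er, eL]; linear_combination (sin (l t) * l') * h
  · refine (hasDerivAt_const t (0 : ℝ)).congr_deriv ?_
    simp [er, eL]; ring

theorem hasDerivAt_er {L l : ℝ → ℝ} {L' l' t : ℝ}
    (hL : HasDerivAt L L' t) (hl : HasDerivAt l l' t) :
    HasDerivAt (fun s => er (L s) (l s))
      (-L' • eL (L t) (l t) - (cos (L t) * l') • el (L t) (l t)) t := by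
  rw [hasDerivAt_pi]
  intro i
  fin_cases i
  · refine (hL.cos.mul hl.cos).neg.congr_deriv ?_
    simp [eL, el]; ring
  · refine (hL.cos.mul hl.sin).neg.congr_deriv ?_
    simp [eL, el]; ring
  · refine hL.sin.neg.congr_deriv ?_
    simp [eL, el]; ring

/-- Under the kinematic relations for `L'` and `ℓ'`, the derivative of the velocity
vector `v_vec = v · i₁` decomposes in the first velocity frame as
`v_vec' = v' i₁ + (v γ' − (v²/r) cos γ) j₁ + (v cos γ χ' − (v²/r) cos²γ sin χ tan L) k₁`. -/
theorem stmt4 (a b : ℝ) (r L l v γ χ r' L' l' v' γ' χ' : ℝ → ℝ)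
    (hrpos : ∀ t ∈ Set.Ioo a b, 0 < r t)
    (hcosL : ∀ t ∈ Set.Ioo a b, cos (L t) ≠ 0)
    (hr : ∀ t ∈ Set.Ioo a b, HasDerivAt r (r' t) t)
    (hL : ∀ t ∈ Set.Ioo a b, HasDerivAt L (L' t) t)
    (hl : ∀ t ∈ Set.Ioo a b, HasDerivAt l (l' t) t)
    (hv : ∀ t ∈ Set.Ioo a b, HasDerivAt v (v' t) t)
    (hγ : ∀ t ∈ Set.Ioo a b, HasDerivAt γ (γ' t) t)
    (hχ : ∀ t ∈ Set.Ioo a b, HasDerivAt χ (χ' t) t)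
    (hkinL : ∀ t ∈ Set.Ioo a b, L' t = (v t / r t) * cos (γ t) * cos (χ t))
    (hkinl : ∀ t ∈ Set.Ioo a b,
      l' t = (v t / r t) * (cos (γ t) * sin (χ t) / cos (L t))) :
    ∀ t ∈ Set.Ioo a b,
      HasDerivAt (fun s => v s • i1 (L s) (l s) (γ s) (χ s))
        (v' t • i1 (L t) (l t) (γ t) (χ t)
          + (v t * γ' t - (v t) ^ 2 / r t * cos (γ t)) • j1 (L t) (l t) (γ t) (χ t)
          + (v t * cos (γ t) * χ' t
              - (v t) ^ 2 / r t * (cos (γ t)) ^ 2 * sin (χ t) * tan (L t))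
            • k1 (L t) (l t) (γ t) (χ t)) t := by
  intro t ht
  have hc := hcosL t ht
  have hr0 := (hrpos t ht).ne'
  have hLt := hL t ht
  have hlt := hl t ht
  have hγt := hγ t ht
  have hχt := hχ t ht
  have hi1 := (((hγt.cos.mul hχt.cos).smul (hasDerivAt_eL hLt hlt)).add
    ((hγt.cos.mul hχt.sin).smul (hasDerivAt_el L hlt))).sub
    (hγt.sin.smul (hasDerivAt_er hLt hlt))
  refine ((hv t ht).smul hi1).congr_deriv ?_
  have hχsq := sin_sq_add_cos_sq (χ t)
  simp only [i1, j1, k1, hkinL t ht, hkinl t ht, tan_eq_sin_div_cos, Pi.mul_apply, Pi.add_apply,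
    Pi.sub_apply, Pi.smul_apply']
  match_scalars
  · field_simp
    linear_combination (v t ^ 2 * cos (γ t) ^ 2) * hχsq
  · field_simp
    ring
  · field_simp
    ring
end

section
/- Let I ⊆ ℝ be an open interval and r, L, ℓ, v, θ, φ : I → ℝ be differentiable with r(t) > 0, v(t) > 0 and cos L(t) ≠ 0 for all t. Define the position curve r_vec(t) = (r cos L cos ℓ, r cos L sin ℓ, r sin L)(t) ∈ ℝ³ (so that r_vec = −r·e_r). If r_vec'(t) = v(t)·i₂(L(t),ℓ(t),θ(t),φ(t)) for all t ∈ I, then for all t ∈ I: r'(t) = −v cos θ cos φ, L'(t) = (v/r) cos θ sin φ, and ℓ'(t) = (v/r) sin θ / cos L. -/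
open Real

/-- First vector of the second velocity frame. -/
noncomputable def i2 (L l θ φ : ℝ) : Fin 3 → ℝ :=
  (cos θ * sin φ) • eL L l + sin θ • el L l + (cos θ * cos φ) • er L l

theorem ned_dotProduct_eL (x y z L l : ℝ) :
    (x • eL L l + y • el L l + z • er L l) ⬝ᵥ eL L l = x := by
  simp [eL, el, er, dotProduct, Fin.sum_univ_three]
  linear_combination (x * sin L ^ 2 + z * sin L * cos L) * sin_sq_add_cos_sq l
    + x * sin_sq_add_cos_sq L

theorem ned_dotProduct_el (x y z L l : ℝ) :
    (x • eL L l + y • el L l + z • er L l) ⬝ᵥ el L l = y := by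
  simp [eL, el, er, dotProduct, Fin.sum_univ_three]
  linear_combination y * sin_sq_add_cos_sq l

theorem ned_dotProduct_er (x y z L l : ℝ) :
    (x • eL L l + y • el L l + z • er L l) ⬝ᵥ er L l = z := by
  simp [eL, el, er, dotProduct, Fin.sum_univ_three]
  linear_combination (z * cos L ^ 2 + x * sin L * cos L) * sin_sq_add_cos_sq l
    + z * sin_sq_add_cos_sq L

/-- The NED components of a vector are unique. -/
theorem ned_components_unique {x y z x' y' z' L l : ℝ}
    (h : x • eL L l + y • el L l + z • er L l = x' • eL L l + y' • el L l + z' • er L l) :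
    x = x' ∧ y = y' ∧ z = z' := by
  refine ⟨?_, ?_, ?_⟩
  · rw [← ned_dotProduct_eL x y z L l, h, ned_dotProduct_eL]
  · rw [← ned_dotProduct_el x y z L l, h, ned_dotProduct_el]
  · rw [← ned_dotProduct_er x y z L l, h, ned_dotProduct_er]

/-- The velocity of a curve given in spherical coordinates, in the NED frame. -/
theorem hasDerivAt_position {r L l : ℝ → ℝ} {r' L' l' t : ℝ}
    (hr : HasDerivAt r r' t) (hL : HasDerivAt L L' t) (hl : HasDerivAt l l' t) :
    HasDerivAt
      (fun s => (![r s * cos (L s) * cos (l s),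
                   r s * cos (L s) * sin (l s),
                   r s * sin (L s)] : Fin 3 → ℝ))
      ((r t * L') • eL (L t) (l t) + (r t * cos (L t) * l') • el (L t) (l t)
        + (-r') • er (L t) (l t)) t := by
  rw [hasDerivAt_pi]
  intro i
  fin_cases i
  · refine ((hr.mul hL.cos).mul hl.cos).congr_deriv ?_
    simp [eL, el, er]
    ring
  · refine ((hr.mul hL.cos).mul hl.sin).congr_deriv ?_
    simp [eL, el, er]
    ring
  · refine (hr.mul hL.sin).congr_deriv ?_
    simp [eL, el, er]
    ring

/-- If the position curve `r_vec = (r cos L cos ℓ, r cos L sin ℓ, r sin L)` satisfies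
`r_vec' = v · i₂`, then `r' = −v cos θ cos φ`, `L' = (v/r) cos θ sin φ`,
`ℓ' = (v/r) sin θ / cos L`. -/
theorem stmt5 (a b : ℝ) (r L l v θ φ r' L' l' v' θ' φ' : ℝ → ℝ)
    (hrpos : ∀ t ∈ Set.Ioo a b, 0 < r t)
    (hvpos : ∀ t ∈ Set.Ioo a b, 0 < v t)
    (hcosL : ∀ t ∈ Set.Ioo a b, cos (L t) ≠ 0)
    (hr : ∀ t ∈ Set.Ioo a b, HasDerivAt r (r' t) t)
    (hL : ∀ t ∈ Set.Ioo a b, HasDerivAt L (L' t) t)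
    (hl : ∀ t ∈ Set.Ioo a b, HasDerivAt l (l' t) t)
    (hv : ∀ t ∈ Set.Ioo a b, HasDerivAt v (v' t) t)
    (hθ : ∀ t ∈ Set.Ioo a b, HasDerivAt θ (θ' t) t)
    (hφ : ∀ t ∈ Set.Ioo a b, HasDerivAt φ (φ' t) t)
    (hrvec : ∀ t ∈ Set.Ioo a b,
      HasDerivAt
        (fun s => (![r s * cos (L s) * cos (l s),
                     r s * cos (L s) * sin (l s),
                     r s * sin (L s)] : Fin 3 → ℝ))
        (v t • i2 (L t) (l t) (θ t) (φ t)) t) :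
    ∀ t ∈ Set.Ioo a b,
      r' t = -(v t * cos (θ t) * cos (φ t)) ∧
      L' t = (v t / r t) * cos (θ t) * sin (φ t) ∧
      l' t = (v t / r t) * (sin (θ t) / cos (L t)) := by
  intro t ht
  have hr0 := (hrpos t ht).ne'
  have hc := hcosL t ht
  have h := (hasDerivAt_position (hr t ht) (hL t ht) (hl t ht)).unique (hrvec t ht)
  simp only [i2, smul_add, smul_smul] at h
  obtain ⟨hnorth, heast, hdown⟩ := ned_components_unique h
  refine ⟨by linear_combination -hdown, ?_, ?_⟩
  · field_simp
    linear_combination hnorth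
  · field_simp
    linear_combination heast
end

section
/- Let r > 0, v > 0, L ∈ (−π/2, π/2), γ ∈ (−π/2, π/2), and χ ∈ ℝ. Let M be the 3×3 real matrix with rows ( −v cos γ, (v/r) sin γ cos χ, (v/r) sin γ sin χ / cos L ), ( 0, (v/r) cos γ sin χ, −(v/r) cos γ cos χ / cos L ), ( −sin γ, −cos γ cos χ / r, −cos γ sin χ / (r cos L) ). Then det M = v² cos γ / (r² cos L); in particular det M ≠ 0, so the only vector (p_r, p_L, p_ℓ) ∈ ℝ³ with M (p_r, p_L, p_ℓ)ᵀ = 0 is (0,0,0). -/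
open Real Matrix

/-- The coefficient matrix of `(p_r, p_L, p_ℓ)` in the adjoint equations for
`p_γ, p_χ, p_v` along a nonregular arc has determinant `v² cos γ / (r² cos L) ≠ 0`,
so its kernel is trivial. -/
theorem stmt11 (r v L γ χ : ℝ) (hr : 0 < r) (hv : 0 < v)
    (hL : L ∈ Set.Ioo (-(π / 2)) (π / 2)) (hγ : γ ∈ Set.Ioo (-(π / 2)) (π / 2))
    (M : Matrix (Fin 3) (Fin 3) ℝ)
    (hM : M = !![-(v * cos γ), (v / r) * sin γ * cos χ, (v / r) * sin γ * sin χ / cos L;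
                 0, (v / r) * cos γ * sin χ, -((v / r) * cos γ * cos χ / cos L);
                 -sin γ, -(cos γ * cos χ / r), -(cos γ * sin χ / (r * cos L))]) :
    M.det = v ^ 2 * cos γ / (r ^ 2 * cos L) ∧
    M.det ≠ 0 ∧
    ∀ p : Fin 3 → ℝ, M.mulVec p = 0 → p = 0 := by
  have hcL : 0 < cos L := cos_pos_of_mem_Ioo hL
  have hcγ : 0 < cos γ := cos_pos_of_mem_Ioo hγ
  have hdet : M.det = v ^ 2 * cos γ / (r ^ 2 * cos L) := by
    have hfactor : M.det = v ^ 2 * cos γ / (r ^ 2 * cos L) *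
        ((sin γ ^ 2 + cos γ ^ 2) * (sin χ ^ 2 + cos χ ^ 2)) := by
      rw [hM, det_fin_three]
      simp only [of_apply, cons_val]
      field_simp
      ring
    rw [hfactor, sin_sq_add_cos_sq, sin_sq_add_cos_sq, mul_one, mul_one]
  have hne : M.det ≠ 0 := by
    rw [hdet]
    positivity
  exact ⟨hdet, hne, fun _ hp => eq_zero_of_mulVec_eq_zero hne hp⟩
end

section
/- Let J ⊆ ℝ be a nontrivial open interval, and let θ, φ : J → ℝ be differentiable functions that are identically zero on J. Let v, r, ω : J → ℝ with v(t) > 0, r(t) > 0 and ω(t) > 0 for all t ∈ J, let g, L : J → ℝ with cos L(t) ≠ 0, and let z = (z₁,z₂,z₃) : J → ℝ³ satisfy z₁(t)² + z₂(t)² + z₃(t)² = 1 and z₁(t) ≥ 0 for all t ∈ J. Suppose that on J the differential equations θ' = ω z₂ + (v/r) sin θ ( cos φ + sin φ tan L ) − (g/v) sin θ cos φ and φ' = −(ω/cos θ) z₃ + (v/r) cos θ ( sin φ + tan²θ ( sin φ − tan L cos φ ) ) − (g/v) sin φ / cos θ hold. Then z₂(t) = 0, z₃(t) = 0, and z₁(t)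 = 1 for all t ∈ J. -/
open Real

/-- A function vanishing on an open set has zero derivative there. -/
theorem HasDerivAt.eq_zero_of_eqOn_zero {f : ℝ → ℝ} {f' t : ℝ} {s : Set ℝ}
    (hf : HasDerivAt f f' t) (hs : IsOpen s) (ht : t ∈ s) (h0 : ∀ x ∈ s, f x = 0) :
    f' = 0 :=
  hf.unique <| (hasDerivAt_const t (0 : ℝ)).congr_of_eventuallyEq <|
    Filter.eventually_of_mem (hs.mem_nhds ht) h0

/-- Along an arc staying in the singular set of the second chart (`θ ≡ 0`, `φ ≡ 0`), the
angular equations of the dynamics force the nonregular control to be `z = (1, 0, 0)`. -/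
theorem stmt19 (a b : ℝ) (hab : a < b)
    (θ φ v r ω g L z₁ z₂ z₃ : ℝ → ℝ)
    (hθ0 : ∀ t ∈ Set.Ioo a b, θ t = 0)
    (hφ0 : ∀ t ∈ Set.Ioo a b, φ t = 0)
    (hv : ∀ t ∈ Set.Ioo a b, 0 < v t)
    (hr : ∀ t ∈ Set.Ioo a b, 0 < r t)
    (hω : ∀ t ∈ Set.Ioo a b, 0 < ω t)
    (hL : ∀ t ∈ Set.Ioo a b, cos (L t) ≠ 0)
    (hz : ∀ t ∈ Set.Ioo a b, (z₁ t) ^ 2 + (z₂ t) ^ 2 + (z₃ t) ^ 2 = 1 ∧ 0 ≤ z₁ t)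
    (hθ' : ∀ t ∈ Set.Ioo a b,
      HasDerivAt θ
        (ω t * z₂ t
          + v t / r t * sin (θ t) * (cos (φ t) + sin (φ t) * tan (L t))
          - g t / v t * sin (θ t) * cos (φ t)) t)
    (hφ' : ∀ t ∈ Set.Ioo a b,
      HasDerivAt φ
        (-(ω t / cos (θ t)) * z₃ t
          + v t / r t * cos (θ t)
              * (sin (φ t) + (tan (θ t)) ^ 2 * (sin (φ t) - tan (L t) * cos (φ t)))
          - g t / v t * (sin (φ t) / cos (θ t))) t) :
    ∀ t ∈ Set.Ioo a b, z₂ t = 0 ∧ z₃ t = 0 ∧ z₁ t = 1 := by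
  intro t ht
  have hθd := (hθ' t ht).eq_zero_of_eqOn_zero isOpen_Ioo ht hθ0
  have hφd := (hφ' t ht).eq_zero_of_eqOn_zero isOpen_Ioo ht hφ0
  have hωt : ω t ≠ 0 := (hω t ht).ne'
  have h₂ : z₂ t = 0 := by simpa [hθ0 t ht, hφ0 t ht, hωt] using hθd
  have h₃ : z₃ t = 0 := by simpa [hθ0 t ht, hφ0 t ht, hωt] using hφd
  obtain ⟨hsphere, hnonneg⟩ := hz t ht
  refine ⟨h₂, h₃, ?_⟩
  rw [h₂, h₃] at hsphere
  nlinarith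
end
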